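/- Let s > 4 be a real number, let S be a finite set of points in ℝ^d, let W be a well-separated pair decomposition of S with separation constant s, and let E be an edge set obtained by choosing, for each pair {X, Y} ∈ W, exactly one unordered pair {x, y} with x ∈ X and y ∈ Y. Then the graph G = (S, E) is a ((s+4)/(s−4))-spanner of S: for all p, q ∈ S, δ_E(p,q) ≤ ((s+4)/(s−4))·|pq|. -/

import Mathlib

/-- The axes-parallel bounding box of a set `X ⊆ ℝ^d`: the smallest
axes-parallel hyperrectangle containing `X`, described coordinatewise via the
infimum and supremum of each coordinate over `X`. -/
def boundingBox {d : ℕ} (X : Set (EuclideanSpace ℝ (Fin d))) :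
    Set (EuclideanSpace ℝ (Fin d)) :=
  {p | ∀ i : Fin d, sInf ((fun x => x i) '' X) ≤ p i ∧ p i ≤ sSup ((fun x => x i) '' X)}

/-- `X` and `Y` are well-separated with respect to `s`: there are two closed
balls of the same radius `ρ`, one containing the bounding box of `X`, the other
containing the bounding box of `Y`, at distance at least `s·ρ` from each other. -/
def WellSeparated {d : ℕ} (s : ℝ) (X Y : Set (EuclideanSpace ℝ (Fin d))) : Prop :=
  ∃ (c₁ c₂ : EuclideanSpace ℝ (Fin d)) (ρ : ℝ), 0 ≤ ρ ∧
    boundingBox X ⊆ Metric.closedBall c₁ ρ ∧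
    boundingBox Y ⊆ Metric.closedBall c₂ ρ ∧
    ∀ x ∈ Metric.closedBall c₁ ρ, ∀ y ∈ Metric.closedBall c₂ ρ, s * ρ ≤ dist x y

/-- A well-separated pair decomposition of a finite set `S ⊆ ℝ^d` with
separation constant `s`: a finite set of unordered pairs `{X, Y}` of nonempty
subsets of `S`, each pair well-separated with respect to `s`, such that for
every two distinct points `p, q ∈ S` there is exactly one pair `{X, Y}` of the
collection with `p ∈ X` and `q ∈ Y`. -/
def IsWSPD {d : ℕ} (s : ℝ) (S : Finset (EuclideanSpace ℝ (Fin d)))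
    (W : Finset (Sym2 (Set (EuclideanSpace ℝ (Fin d))))) : Prop :=
  (∀ e ∈ W, ∀ X Y : Set (EuclideanSpace ℝ (Fin d)), e = s(X, Y) →
      X.Nonempty ∧ Y.Nonempty ∧ X ⊆ ↑S ∧ Y ⊆ ↑S ∧ WellSeparated s X Y) ∧
  (∀ p ∈ S, ∀ q ∈ S, p ≠ q →
      ∃! e, e ∈ W ∧ ∃ X Y : Set (EuclideanSpace ℝ (Fin d)),
        e = s(X, Y) ∧ p ∈ X ∧ q ∈ Y)

open scoped ENNReal

/-- The length of a walk, given as the list of its vertices. -/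
noncomputable def walkLen {P : Type*} [PseudoEMetricSpace P] (xs : List P) : ℝ≥0∞ :=
  (List.zipWith edist xs xs.tail).sum

/-- `xs` is a walk from `p` to `q` in the graph with edge set `E`. -/
def IsWalk {P : Type*} (E : Set (Sym2 P)) (p q : P) (xs : List P) : Prop :=
  xs.head? = some p ∧ xs.getLast? = some q ∧ xs.Chain' (fun a b => s(a, b) ∈ E)

/-- Graph distance: the infimum of lengths of walks from `p` to `q`. -/
noncomputable def gdist {P : Type*} [PseudoEMetricSpace P] (E : Set (Sym2 P)) (p q : P) :
    ℝ≥0∞ :=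
  ⨅ (xs : List P) (_ : IsWalk E p q xs), walkLen xs

theorem walkLen_cons_cons {P : Type*} [PseudoEMetricSpace P] (a b : P) (l : List P) :
    walkLen (a :: b :: l) = edist a b + walkLen (b :: l) := by
  simp [walkLen]

theorem IsWalk.cons {P : Type*} {E : Set (Sym2 P)} {p a q : P} {xs : List P}
    (h : IsWalk E a q xs) (ha : s(p, a) ∈ E) : IsWalk E p q (p :: xs) := by
  obtain ⟨h₁, h₂, h₃⟩ := h
  cases xs with
  | nil => simp at h₁
  | cons b l =>
    obtain rfl : b = a := by simpa using h₁
    exact ⟨rfl, by simpa using h₂, List.isChain_cons_cons.2 ⟨ha, h₃⟩⟩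

theorem IsWalk.exists_trans {P : Type*} [PseudoEMetricSpace P] {E : Set (Sym2 P)} {r q : P}
    {ys : List P} (hys : IsWalk E r q ys) (xs : List P) :
    ∀ p, IsWalk E p r xs → ∃ zs, IsWalk E p q zs ∧ walkLen zs ≤ walkLen xs + walkLen ys := by
  induction xs with
  | nil => intro p h; simpa using h.1
  | cons a l ih =>
    rintro p ⟨h₁, h₂, h₃⟩
    obtain rfl : a = p := by simpa using h₁
    cases l with
    | nil =>
      obtain rfl : a = r := by simpa using h₂
      exact ⟨ys, hys, le_add_self⟩
    | cons b l =>
      obtain ⟨hab, hl⟩ := List.isChain_cons_cons.1 h₃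
      obtain ⟨zs, hz, hlen⟩ := ih b ⟨rfl, by simpa using h₂, hl⟩
      refine ⟨a :: zs, hz.cons hab, ?_⟩
      cases zs with
      | nil => simpa using hz.1
      | cons c zs =>
        obtain rfl : c = b := by simpa using hz.1
        rw [walkLen_cons_cons, walkLen_cons_cons, add_assoc]
        gcongr

theorem gdist_le_walkLen {P : Type*} [PseudoEMetricSpace P] {E : Set (Sym2 P)} {p q : P}
    {xs : List P} (h : IsWalk E p q xs) : gdist E p q ≤ walkLen xs :=
  iInf₂_le xs h

theorem gdist_self {P : Type*} [PseudoEMetricSpace P] (E : Set (Sym2 P)) (p : P) :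
    gdist E p p = 0 := by
  have h : IsWalk E p p [p] := ⟨rfl, rfl, List.isChain_singleton p⟩
  simpa [walkLen] using gdist_le_walkLen h

theorem gdist_le_edist {P : Type*} [PseudoEMetricSpace P] {E : Set (Sym2 P)} {p q : P}
    (h : s(p, q) ∈ E) : gdist E p q ≤ edist p q := by
  have hw : IsWalk E p q [p, q] :=
    IsWalk.cons (a := q) ⟨rfl, rfl, List.isChain_singleton q⟩ h
  simpa [walkLen] using gdist_le_walkLen hw

theorem gdist_triangle {P : Type*} [PseudoEMetricSpace P] (E : Set (Sym2 P)) (p r q : P) :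
    gdist E p q ≤ gdist E p r + gdist E r q := by
  refine ENNReal.le_of_forall_pos_le_add fun ε hε hlt => ?_
  have hε' : (0 : ℝ≥0∞) < ε / 2 := by simpa using hε.ne'
  obtain ⟨h₁, h₂⟩ := ENNReal.add_lt_top.1 hlt
  have h₁' : gdist E p r < gdist E p r + ε / 2 := ENNReal.lt_add_right h₁.ne hε'.ne'
  have h₂' : gdist E r q < gdist E r q + ε / 2 := ENNReal.lt_add_right h₂.ne hε'.ne'
  obtain ⟨xs, hxs, hx⟩ : ∃ xs, IsWalk E p r xs ∧ walkLen xs < gdist E p r + ε / 2 := by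
    simpa only [gdist, iInf_lt_iff, exists_prop] using h₁'
  obtain ⟨ys, hys, hy⟩ : ∃ ys, IsWalk E r q ys ∧ walkLen ys < gdist E r q + ε / 2 := by
    simpa only [gdist, iInf_lt_iff, exists_prop] using h₂'
  obtain ⟨zs, hzs, hz⟩ := hys.exists_trans xs p hxs
  calc gdist E p q ≤ walkLen zs := gdist_le_walkLen hzs
    _ ≤ walkLen xs + walkLen ys := hz
    _ ≤ (gdist E p r + ε / 2) + (gdist E r q + ε / 2) := add_le_add hx.le hy.le
    _ = gdist E p r + gdist E r q + ε := by
      rw [add_add_add_comm, ENNReal.add_halves]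

theorem subset_boundingBox {d : ℕ} {X : Set (EuclideanSpace ℝ (Fin d))} (hX : X.Finite) :
    X ⊆ boundingBox X := fun x hx _ =>
  ⟨csInf_le (hX.image _).bddBelow ⟨x, hx, rfl⟩, le_csSup (hX.image _).bddAbove ⟨x, hx, rfl⟩⟩

theorem WellSeparated.exists_dist_le {d : ℕ} {s : ℝ} {X Y : Set (EuclideanSpace ℝ (Fin d))}
    (h : WellSeparated s X Y) (hX : X.Finite) (hY : Y.Finite) :
    ∃ ρ : ℝ, (∀ x ∈ X, ∀ x' ∈ X, dist x x' ≤ 2 * ρ) ∧ (∀ y ∈ Y, ∀ y' ∈ Y, dist y y' ≤ 2 * ρ) ∧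
      ∀ x ∈ X, ∀ y ∈ Y, s * ρ ≤ dist x y := by
  obtain ⟨c₁, c₂, ρ, -, h₁, h₂, hd⟩ := h
  have hX' := (subset_boundingBox hX).trans h₁
  have hY' := (subset_boundingBox hY).trans h₂
  refine ⟨ρ, fun x hx x' hx' => ?_, fun y hy y' hy' => ?_,
    fun x hx y hy => hd x (hX' hx) y (hY' hy)⟩
  · linarith [dist_triangle_right x x' c₁, Metric.mem_closedBall.1 (hX' hx),
      Metric.mem_closedBall.1 (hX' hx')]
  · linarith [dist_triangle_right y y' c₂, Metric.mem_closedBall.1 (hY' hy),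
      Metric.mem_closedBall.1 (hY' hy')]

theorem IsWSPD.exists_edge {d : ℕ} {s : ℝ} {S : Finset (EuclideanSpace ℝ (Fin d))}
    {W : Finset (Sym2 (Set (EuclideanSpace ℝ (Fin d))))} (hW : IsWSPD s S W) (hs : 0 < s)
    {f : Sym2 (Set (EuclideanSpace ℝ (Fin d))) → Sym2 (EuclideanSpace ℝ (Fin d))}
    (hf : ∀ e ∈ W, ∀ X Y : Set (EuclideanSpace ℝ (Fin d)), e = s(X, Y) →
      ∃ x ∈ X, ∃ y ∈ Y, f e = s(x, y))
    {p q : EuclideanSpace ℝ (Fin d)} (hp : p ∈ S) (hq : q ∈ S) (hpq : p ≠ q) :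
    ∃ x ∈ S, ∃ y ∈ S, s(x, y) ∈ f '' (W : Set (Sym2 (Set (EuclideanSpace ℝ (Fin d))))) ∧
      dist p x ≤ 2 / s * dist p q ∧ dist y q ≤ 2 / s * dist p q := by
  obtain ⟨e, ⟨he, X, Y, hXY, hpX, hqY⟩, -⟩ := hW.2 p hp q hq hpq
  obtain ⟨-, -, hXS, hYS, hsep⟩ := hW.1 e he X Y hXY
  obtain ⟨x, hx, y, hy, hxy⟩ := hf e he X Y hXY
  obtain ⟨ρ, h₁, h₂, h₃⟩ :=
    hsep.exists_dist_le (S.finite_toSet.subset hXS) (S.finite_toSet.subset hYS)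
  have hρ : 2 * ρ ≤ 2 / s * dist p q := by
    rw [div_mul_eq_mul_div, le_div_iff₀ hs]
    linarith [h₃ p hpX q hqY]
  exact ⟨x, hXS hx, y, hYS hy, ⟨e, he, hxy⟩, (h₁ p hpX x hx).trans hρ, (h₂ y hy q hqY).trans hρ⟩

/-- Picking one edge `{x, y}` with `x ∈ X`, `y ∈ Y` from each pair `{X, Y}` of a
WSPD with separation constant `s > 4` yields a `((s+4)/(s−4))`-spanner of `S`. -/
theorem wspd_spanner {d : ℕ} (s : ℝ) (hs : 4 < s)
    (S : Finset (EuclideanSpace ℝ (Fin d)))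
    (W : Finset (Sym2 (Set (EuclideanSpace ℝ (Fin d)))))
    (hW : IsWSPD s S W)
    (f : Sym2 (Set (EuclideanSpace ℝ (Fin d))) → Sym2 (EuclideanSpace ℝ (Fin d)))
    (hf : ∀ e ∈ W, ∀ X Y : Set (EuclideanSpace ℝ (Fin d)), e = s(X, Y) →
      ∃ x ∈ X, ∃ y ∈ Y, f e = s(x, y))
    (E : Set (Sym2 (EuclideanSpace ℝ (Fin d))))
    (hE : E = f '' (↑W : Set (Sym2 (Set (EuclideanSpace ℝ (Fin d)))))) :
    ∀ p ∈ S, ∀ q ∈ S,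
      gdist E p q ≤ ENNReal.ofReal ((s + 4) / (s - 4)) * edist p q := by
  subst hE
  by_contra! hbad
  obtain ⟨p₀, hp₀, q₀, hq₀, h₀⟩ := hbad
  set E := f '' (W : Set (Sym2 (Set (EuclideanSpace ℝ (Fin d)))))
  set t := (s + 4) / (s - 4) with ht
  have hs' : 0 < s := by linarith
  have ht0 : 0 ≤ t := div_nonneg (by linarith) (by linarith)
  classical
  obtain ⟨⟨p, q⟩, hmem, hmin⟩ := Finset.exists_min_image
    ((S ×ˢ S).filter fun z => ENNReal.ofReal t * edist z.1 z.2 < gdist E z.1 z.2)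
    (fun z => dist z.1 z.2) ⟨(p₀, q₀), by simp [hp₀, hq₀, h₀]⟩
  simp only [Finset.mem_filter, Finset.mem_product] at hmem
  obtain ⟨⟨hp, hq⟩, hlt⟩ := hmem
  have hclose : ∀ a ∈ S, ∀ b ∈ S, dist a b < dist p q →
      gdist E a b ≤ ENNReal.ofReal (t * dist a b) := by
    intro a ha b hb hab
    rw [ENNReal.ofReal_mul ht0, ← edist_dist]
    by_contra! hc
    exact hab.not_ge (hmin (a, b) (by simp [ha, hb, hc]))
  have hpq : p ≠ q := by
    rintro rfl
    simp [gdist_self] at hlt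
  obtain ⟨x, hx, y, hy, hxy, hpx, hyq⟩ := hW.exists_edge hs' hf hp hq hpq
  have hshrink : 2 / s * dist p q < dist p q :=
    mul_lt_of_lt_one_left (dist_pos.2 hpq) ((div_lt_one hs').2 (by linarith))
  have hbound : t * dist p x + dist x y + t * dist y q ≤ t * dist p q := by
    have hxy' : dist x y ≤ dist p x + dist p q + dist y q := by
      have := dist_triangle4 x p q y
      rwa [dist_comm x p, dist_comm q y] at this
    have h₁ := mul_le_mul_of_nonneg_left hpx ht0
    have h₂ := mul_le_mul_of_nonneg_left hyq ht0
    have hfix : t * (2 / s * dist p q) + (2 / s * dist p q + dist p q + 2 / s * dist p q) +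
        t * (2 / s * dist p q) = t * dist p q := by
      have : s - 4 ≠ 0 := by linarith
      rw [ht]
      field_simp
      ring
    linarith
  refine hlt.not_ge ?_
  calc gdist E p q ≤ gdist E p x + gdist E x y + gdist E y q :=
        (gdist_triangle E p y q).trans (by gcongr; exact gdist_triangle E p x y)
    _ ≤ ENNReal.ofReal (t * dist p x) + ENNReal.ofReal (dist x y) +
        ENNReal.ofReal (t * dist y q) := by
      gcongr
      · exact hclose p hp x hx (hpx.trans_lt hshrink)
      · rw [← edist_dist]
        exact gdist_le_edist hxy
      · exact hclose y hy q hq (hyq.trans_lt hshrink)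
    _ = ENNReal.ofReal (t * dist p x + dist x y + t * dist y q) := by
      rw [ENNReal.ofReal_add (by positivity) (by positivity),
        ENNReal.ofReal_add (by positivity) (by positivity)]
    _ ≤ ENNReal.ofReal (t * dist p q) := ENNReal.ofReal_le_ofReal hbound
    _ = ENNReal.ofReal t * edist p q := by
      rw [ENNReal.ofReal_mul ht0, ← edist_dist]
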